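/- arXiv:2501.18067 — 4 statements merged into one kernel-verified Lean document; each statement's English description precedes it below -/
import Mathlib

section
/- Let J be the superalgebra (2,2)₅₂. For every even supersymmetric 2-cocycle h : J × J → J there exists an even F-linear map μ : J → J with h(a,b) = aμ(b) + μ(a)b − μ(ab) for all a, b; that is, the even part of the second cohomology group H²(J,J) vanishes. -/
namespace JS22

variable (F : Type*) [Field F] [CharZero F]

/-- The underlying ℤ₂-graded vector space `J = F⁴`: coordinates `0,1` are the even
basis vectors `e₁, e₂` and coordinates `2,3` are the odd basis vectors `f₁, f₂`. -/
abbrev J : Type _ := Fin 4 → F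

def e1 : J F := ![1, 0, 0, 0]
def e2 : J F := ![0, 1, 0, 0]
def f1 : J F := ![0, 0, 1, 0]
def f2 : J F := ![0, 0, 0, 1]

/-- The even part `J₀ = span {e₁, e₂}`. -/
def J0 : Submodule F (J F) := Submodule.span F {e1 F, e2 F}

/-- The odd part `J₁ = span {f₁, f₂}`. -/
def J1 : Submodule F (J F) := Submodule.span F {f1 F, f2 F}

/-- `x` is homogeneous of degree `d ∈ {0, 1}`. -/
def IsHomog (x : J F) (d : ℕ) : Prop :=
  (d = 0 ∧ x ∈ J0 F) ∨ (d = 1 ∧ x ∈ J1 F)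

/-- A (bilinear) multiplication is supercommutative: `x y = (−1)^{|x||y|} y x`. -/
def IsSuperComm (mul : J F → J F → J F) : Prop :=
  ∀ x y : J F, ∀ dx dy : ℕ, IsHomog F x dx → IsHomog F y dy →
    mul x y = ((-1 : F) ^ (dx * dy)) • mul y x

/-- The Jordan superidentity, for all homogeneous `w, x, y, z`. -/
def SatisfiesJordanSuperId (mul : J F → J F → J F) : Prop :=
  ∀ w x y z : J F, ∀ dw dx dy dz : ℕ,
    IsHomog F w dw → IsHomog F x dx → IsHomog F y dy → IsHomog F z dz →
    mul (mul w x) (mul y z)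
      + ((-1 : F) ^ (dx * dy)) • mul (mul w y) (mul x z)
      + ((-1 : F) ^ ((dx + dy) * dz)) • mul (mul w z) (mul x y)
      - ((-1 : F) ^ (dw * dx)) • mul x (mul w (mul y z))
      - ((-1 : F) ^ (dy * (dw + dx))) • mul y (mul w (mul x z))
      - ((-1 : F) ^ (dz * (dw + dx + dy))) • mul z (mul w (mul x y)) = 0

/-- `F(a,b,c,d) = h((ab)c, d) + h(ab,c)·d + (h(a,b)·c)·d`. -/
def Fc (mul : J F → J F → J F) (h : J F →ₗ[F] J F →ₗ[F] J F) (a b c d : J F) : J F :=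
  h (mul (mul a b) c) d + mul (h (mul a b) c) d + mul (mul (h a b) c) d

/-- `G(a,b,c,d) = h(ab, cd) + h(a,b)·(cd) + (ab)·h(c,d)`. -/
def Gc (mul : J F → J F → J F) (h : J F →ₗ[F] J F →ₗ[F] J F) (a b c d : J F) : J F :=
  h (mul a b) (mul c d) + mul (h a b) (mul c d) + mul (mul a b) (h c d)

/-- Supersymmetry of `h`: `h(a,b) = (−1)^{|a||b|} h(b,a)` for homogeneous `a, b`. -/
def IsSuperSym (h : J F →ₗ[F] J F →ₗ[F] J F) : Prop :=
  ∀ a b : J F, ∀ da db : ℕ, IsHomog F a da → IsHomog F b db →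
    h a b = ((-1 : F) ^ (da * db)) • h b a

/-- The 2-cocycle identity for `h` with respect to the multiplication `mul`. -/
def IsCocycleId (mul : J F → J F → J F) (h : J F →ₗ[F] J F →ₗ[F] J F) : Prop :=
  ∀ a b c d : J F, ∀ da db dc dd : ℕ,
    IsHomog F a da → IsHomog F b db → IsHomog F c dc → IsHomog F d dd →
    Fc F mul h a b c d + ((-1 : F) ^ (db * (dc + dd) + dc * dd)) • Fc F mul h a d c b
      + ((-1 : F) ^ (da * (db + dc + dd) + dc * dd)) • Fc F mul h b d c a
    = Gc F mul h a b c d + ((-1 : F) ^ (db * dc)) • Gc F mul h a c b d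
      + ((-1 : F) ^ (dd * (dc + db))) • Gc F mul h a d b c

/-- `h` is a supersymmetric 2-cocycle. -/
def IsSuperCocycle (mul : J F → J F → J F) (h : J F →ₗ[F] J F →ₗ[F] J F) : Prop :=
  IsSuperSym F h ∧ IsCocycleId F mul h

/-- `h` is a coboundary: `h(a,b) = a·μ(b) + μ(a)·b − μ(a·b)` for some linear `μ`. -/
def IsCoboundary (mul : J F → J F → J F) (h : J F →ₗ[F] J F →ₗ[F] J F) : Prop :=
  ∃ μ : J F →ₗ[F] J F, ∀ a b : J F, h a b = mul a (μ b) + mul (μ a) b - μ (mul a b)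

/-- The bilinear map `h` is even: `h(J_i × J_j) ⊆ J_{i+j}`. -/
def IsEvenBilin (h : J F →ₗ[F] J F →ₗ[F] J F) : Prop :=
  (∀ a ∈ J0 F, ∀ b ∈ J0 F, h a b ∈ J0 F) ∧
  (∀ a ∈ J0 F, ∀ b ∈ J1 F, h a b ∈ J1 F) ∧
  (∀ a ∈ J1 F, ∀ b ∈ J0 F, h a b ∈ J1 F) ∧
  (∀ a ∈ J1 F, ∀ b ∈ J1 F, h a b ∈ J0 F)

/-- The linear map `μ` is even: `μ(J_i) ⊆ J_i`. -/
def IsEvenLin (μ : J F →ₗ[F] J F) : Prop :=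
  (∀ a ∈ J0 F, μ a ∈ J0 F) ∧ (∀ a ∈ J1 F, μ a ∈ J1 F)

/-- `φ` is a graded algebra isomorphism from `(J, mulA)` onto `(J, mulB)`. -/
def IsGradedIso (mulA mulB : J F → J F → J F) (φ : J F → J F) : Prop :=
  IsLinearMap F φ ∧ Function.Bijective φ ∧
  φ '' (J0 F : Set (J F)) = (J0 F : Set (J F)) ∧
  φ '' (J1 F : Set (J F)) = (J1 F : Set (J F)) ∧
  ∀ x y : J F, φ (mulA x y) = mulB (φ x) (φ y)

/-- `D_γ`: `e₁²=e₁`, `e₂²=e₂`, `eᵢfⱼ = ½fⱼ`, `f₁f₂ = e₁ + γe₂`. -/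
def mulD (γ : F) (x y : J F) : J F :=
  ![x 0 * y 0 + (x 2 * y 3 - x 3 * y 2),
    x 1 * y 1 + γ * (x 2 * y 3 - x 3 * y 2),
    ((x 0 + x 1) * y 2 + x 2 * (y 0 + y 1)) / 2,
    ((x 0 + x 1) * y 3 + x 3 * (y 0 + y 1)) / 2]

/-- `(2,2)₁`: `e₁²=e₁`, `e₂²=e₂`. -/
def mul1 (x y : J F) : J F :=
  ![x 0 * y 0, x 1 * y 1, 0, 0]

/-- `(2,2)₃`: `e₁²=e₁`, `e₂²=e₂`, `e₁f₁=½f₁`, `e₁f₂=½f₂`, `f₁f₂=e₁`. -/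
def mul3 (x y : J F) : J F :=
  ![x 0 * y 0 + (x 2 * y 3 - x 3 * y 2), x 1 * y 1,
    (x 0 * y 2 + x 2 * y 0) / 2, (x 0 * y 3 + x 3 * y 0) / 2]

/-- `(2,2)₅`: `e₁²=e₁`, `e₂²=e₂`, `e₁f₁=f₁`, `e₁f₂=f₂`, `f₁f₂=e₁`. -/
def mul5 (x y : J F) : J F :=
  ![x 0 * y 0 + (x 2 * y 3 - x 3 * y 2), x 1 * y 1,
    x 0 * y 2 + x 2 * y 0, x 0 * y 3 + x 3 * y 0]

/-- `(2,2)₇`: `e₁²=e₁`, `e₂²=e₂`, `eᵢfⱼ=½fⱼ`, `f₁f₂=e₂`. -/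
def mul7 (x y : J F) : J F :=
  ![x 0 * y 0, x 1 * y 1 + (x 2 * y 3 - x 3 * y 2),
    ((x 0 + x 1) * y 2 + x 2 * (y 0 + y 1)) / 2,
    ((x 0 + x 1) * y 3 + x 3 * (y 0 + y 1)) / 2]

/-- `(2,2)₈`: `e₁²=e₁`, `e₂²=e₂`, `e₁f₁=½f₁`. -/
def mul8 (x y : J F) : J F :=
  ![x 0 * y 0, x 1 * y 1, (x 0 * y 2 + x 2 * y 0) / 2, 0]

/-- `(2,2)₂₆`: `e₁²=e₁`, `e₁f₁=½f₁`, `e₁f₂=½f₂`, `f₁f₂=e₁+e₂`. -/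
def mul26 (x y : J F) : J F :=
  ![x 0 * y 0 + (x 2 * y 3 - x 3 * y 2), x 2 * y 3 - x 3 * y 2,
    (x 0 * y 2 + x 2 * y 0) / 2, (x 0 * y 3 + x 3 * y 0) / 2]

/-- `(2,2)₄₃`: `e₁²=e₁`, `e₁e₂=e₂`, `e₁f₁=f₁`, `e₁f₂=f₂`, `f₁f₂=e₁+e₂`. -/
def mul43 (x y : J F) : J F :=
  ![x 0 * y 0 + (x 2 * y 3 - x 3 * y 2),
    x 0 * y 1 + x 1 * y 0 + (x 2 * y 3 - x 3 * y 2),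
    x 0 * y 2 + x 2 * y 0, x 0 * y 3 + x 3 * y 0]

/-- `(2,2)₅₂`: `e₁²=e₁`, `e₁e₂=½e₂`. -/
def mul52 (x y : J F) : J F :=
  ![x 0 * y 0, (x 0 * y 1 + x 1 * y 0) / 2, 0, 0]

/-- `(2,2)₅₇`: `e₁²=e₁`, `e₁e₂=½e₂`, `e₁f₂=f₂`. -/
def mul57 (x y : J F) : J F :=
  ![x 0 * y 0, (x 0 * y 1 + x 1 * y 0) / 2, 0, x 0 * y 3 + x 3 * y 0]

/-- `(2,2)₆₀`: `e₁²=e₁`, `e₁e₂=½e₂`, `e₁f₁=½f₁`, `e₁f₂=½f₂`. -/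
def mul60 (x y : J F) : J F :=
  ![x 0 * y 0, (x 0 * y 1 + x 1 * y 0) / 2,
    (x 0 * y 2 + x 2 * y 0) / 2, (x 0 * y 3 + x 3 * y 0) / 2]

/-- `(2,2)₆₇`: `e₁²=e₁`, `e₁e₂=½e₂`, `e₁f₁=f₁`, `e₁f₂=f₂`. -/
def mul67 (x y : J F) : J F :=
  ![x 0 * y 0, (x 0 * y 1 + x 1 * y 0) / 2,
    x 0 * y 2 + x 2 * y 0, x 0 * y 3 + x 3 * y 0]


set_option linter.unusedSectionVars false
set_option linter.unusedSimpArgs false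

lemma mem_J0 {x : J F} (hx : x ∈ J0 F) : x 2 = 0 ∧ x 3 = 0 := by
  obtain ⟨a, b, rfl⟩ := Submodule.mem_span_pair.1 hx
  simp [e1, e2]

lemma mem_J1 {x : J F} (hx : x ∈ J1 F) : x 0 = 0 ∧ x 1 = 0 := by
  obtain ⟨a, b, rfl⟩ := Submodule.mem_span_pair.1 hx
  simp [f1, f2]

lemma e1_mem : e1 F ∈ J0 F := Submodule.subset_span (by simp)
lemma e2_mem : e2 F ∈ J0 F := Submodule.subset_span (by simp)
lemma f1_mem : f1 F ∈ J1 F := Submodule.subset_span (by simp)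
lemma f2_mem : f2 F ∈ J1 F := Submodule.subset_span (by simp)

lemma m11 : mul52 F (e1 F) (e1 F) = e1 F := by
  ext i; fin_cases i <;> simp [mul52, e1]
lemma m12 : mul52 F (e1 F) (e2 F) = (1 / 2 : F) • e2 F := by
  ext i; fin_cases i <;> simp [mul52, e1, e2]
lemma m21 : mul52 F (e2 F) (e1 F) = (1 / 2 : F) • e2 F := by
  ext i; fin_cases i <;> simp [mul52, e1, e2]
lemma m22 : mul52 F (e2 F) (e2 F) = 0 := by
  ext i; fin_cases i <;> simp [mul52, e2]
lemma ms1 (c : F) (x y : J F) : mul52 F (c • x) y = c • mul52 F x y := by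
  ext i; fin_cases i <;> simp [mul52] <;> ring
lemma ms2 (c : F) (x y : J F) : mul52 F x (c • y) = c • mul52 F x y := by
  ext i; fin_cases i <;> simp [mul52] <;> ring
lemma mz1 (y : J F) : mul52 F 0 y = 0 := by
  ext i; fin_cases i <;> simp [mul52]
lemma mz2 (y : J F) : mul52 F y 0 = 0 := by
  ext i; fin_cases i <;> simp [mul52]
lemma mf1 (y : J F) : mul52 F y (f1 F) = 0 := by
  ext i; fin_cases i <;> simp [mul52, f1]
lemma mf2 (y : J F) : mul52 F y (f2 F) = 0 := by
  ext i; fin_cases i <;> simp [mul52, f2]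
lemma mf3 (y : J F) : mul52 F (f1 F) y = 0 := by
  ext i; fin_cases i <;> simp [mul52, f1]
lemma mf4 (y : J F) : mul52 F (f2 F) y = 0 := by
  ext i; fin_cases i <;> simp [mul52, f2]
lemma c0 (x y : J F) : mul52 F x y 0 = x 0 * y 0 := rfl
lemma c1 (x y : J F) : mul52 F x y 1 = (x 0 * y 1 + x 1 * y 0) / 2 := rfl
lemma c2 (x y : J F) : mul52 F x y 2 = 0 := rfl
lemma c3 (x y : J F) : mul52 F x y 3 = 0 := rfl
lemma e10 : e1 F 0 = 1 := rfl
lemma e11 : e1 F 1 = 0 := rfl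
lemma e20 : e2 F 0 = 0 := rfl
lemma e21 : e2 F 1 = 1 := rfl

lemma decomp (x : J F) : x = x 0 • e1 F + x 1 • e2 F + x 2 • f1 F + x 3 • f2 F := by
  ext i; fin_cases i <;> simp [e1, e2, f1, f2]

lemma eq_of_mem_J0 {x : J F} {a b : F} (hx : x ∈ J0 F) (h0 : x 0 = a) (h1 : x 1 = b) :
    x = a • e1 F + b • e2 F := by
  obtain ⟨h2, h3⟩ := mem_J0 F hx
  rw [decomp F x, h0, h1, h2, h3]; simp

lemma eq_zero_of_mem_J1 {x : J F} (hx : x ∈ J1 F) (h2 : x 2 = 0) (h3 : x 3 = 0) :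
    x = 0 := by
  obtain ⟨h0, h1⟩ := mem_J1 F hx
  rw [decomp F x, h0, h1, h2, h3]; simp

/-- for `J = (2,2)₅₂`, every even supersymmetric 2-cocycle is the
coboundary of an even linear map, i.e. the even part of `H²(J,J)` vanishes. -/
theorem even_H2_vanishes_mul52 (h : J F →ₗ[F] J F →ₗ[F] J F)
    (hev : IsEvenBilin F h) (hc : IsSuperCocycle F (mul52 F) h) :
    ∃ μ : J F →ₗ[F] J F, IsEvenLin F μ ∧
      ∀ a b : J F, h a b = mul52 F a (μ b) + mul52 F (μ a) b - μ (mul52 F a b) := by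
  obtain ⟨hs, hco⟩ := hc
  obtain ⟨h00, h01, h10, h11⟩ := hev
  have E1 : IsHomog F (e1 F) 0 := Or.inl ⟨rfl, e1_mem F⟩
  have E2 : IsHomog F (e2 F) 0 := Or.inl ⟨rfl, e2_mem F⟩
  have F1 : IsHomog F (f1 F) 1 := Or.inr ⟨rfl, f1_mem F⟩
  have F2 : IsHomog F (f2 F) 1 := Or.inr ⟨rfl, f2_mem F⟩
  have s21 : h (e2 F) (e1 F) = h (e1 F) (e2 F) := by simpa using hs _ _ _ _ E2 E1
  have s31 : h (f1 F) (e1 F) = h (e1 F) (f1 F) := by simpa using hs _ _ _ _ F1 E1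
  have s41 : h (f2 F) (e1 F) = h (e1 F) (f2 F) := by simpa using hs _ _ _ _ F2 E1
  have s32 : h (f1 F) (e2 F) = h (e2 F) (f1 F) := by simpa using hs _ _ _ _ F1 E2
  have s42 : h (f2 F) (e2 F) = h (e2 F) (f2 F) := by simpa using hs _ _ _ _ F2 E2
  have s43 : h (f2 F) (f1 F) = - h (f1 F) (f2 F) := by simpa using hs _ _ _ _ F2 F1
  have s33 : h (f1 F) (f1 F) = 0 := by
    have := hs _ _ _ _ F1 F1
    simpa [self_eq_neg] using this
  have s44 : h (f2 F) (f2 F) = 0 := by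
    have := hs _ _ _ _ F2 F2
    simpa [self_eq_neg] using this
  have q0000 := hco _ _ _ _ _ _ _ _ E1 E1 E1 E1
  simp only [Fc, Gc, m11, m12, m21, m22, ms1, ms2, mz1, mz2, mf1, mf2, mf3, mf4,
    map_smul, map_zero, LinearMap.smul_apply, LinearMap.zero_apply,
    s21, s31, s41, s32, s42, s43] at q0000
  have q0000_1 := congrFun q0000 1
  simp only [Pi.add_apply, Pi.smul_apply, Pi.neg_apply, Pi.zero_apply, smul_eq_mul, c0, c1, c2, c3,
    e10, e11, e20, e21] at q0000_1
  have q0001 := hco _ _ _ _ _ _ _ _ E1 E1 E1 E2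
  simp only [Fc, Gc, m11, m12, m21, m22, ms1, ms2, mz1, mz2, mf1, mf2, mf3, mf4,
    map_smul, map_zero, LinearMap.smul_apply, LinearMap.zero_apply,
    s21, s31, s41, s32, s42, s43] at q0001
  have q0001_1 := congrFun q0001 1
  simp only [Pi.add_apply, Pi.smul_apply, Pi.neg_apply, Pi.zero_apply, smul_eq_mul, c0, c1, c2, c3,
    e10, e11, e20, e21] at q0001_1
  have q0002 := hco _ _ _ _ _ _ _ _ E1 E1 E1 F1
  simp only [Fc, Gc, m11, m12, m21, m22, ms1, ms2, mz1, mz2, mf1, mf2, mf3, mf4,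
    map_smul, map_zero, LinearMap.smul_apply, LinearMap.zero_apply,
    s21, s31, s41, s32, s42, s43] at q0002
  have q0002_2 := congrFun q0002 2
  simp only [Pi.add_apply, Pi.smul_apply, Pi.neg_apply, Pi.zero_apply, smul_eq_mul, c0, c1, c2, c3,
    e10, e11, e20, e21] at q0002_2
  have q0002_3 := congrFun q0002 3
  simp only [Pi.add_apply, Pi.smul_apply, Pi.neg_apply, Pi.zero_apply, smul_eq_mul, c0, c1, c2, c3,
    e10, e11, e20, e21] at q0002_3
  have q0003 := hco _ _ _ _ _ _ _ _ E1 E1 E1 F2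
  simp only [Fc, Gc, m11, m12, m21, m22, ms1, ms2, mz1, mz2, mf1, mf2, mf3, mf4,
    map_smul, map_zero, LinearMap.smul_apply, LinearMap.zero_apply,
    s21, s31, s41, s32, s42, s43] at q0003
  have q0003_2 := congrFun q0003 2
  simp only [Pi.add_apply, Pi.smul_apply, Pi.neg_apply, Pi.zero_apply, smul_eq_mul, c0, c1, c2, c3,
    e10, e11, e20, e21] at q0003_2
  have q0003_3 := congrFun q0003 3
  simp only [Pi.add_apply, Pi.smul_apply, Pi.neg_apply, Pi.zero_apply, smul_eq_mul, c0, c1, c2, c3,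
    e10, e11, e20, e21] at q0003_3
  have q0012 := hco _ _ _ _ _ _ _ _ E1 E1 E2 F1
  simp only [Fc, Gc, m11, m12, m21, m22, ms1, ms2, mz1, mz2, mf1, mf2, mf3, mf4,
    map_smul, map_zero, LinearMap.smul_apply, LinearMap.zero_apply,
    s21, s31, s41, s32, s42, s43] at q0012
  have q0012_2 := congrFun q0012 2
  simp only [Pi.add_apply, Pi.smul_apply, Pi.neg_apply, Pi.zero_apply, smul_eq_mul, c0, c1, c2, c3,
    e10, e11, e20, e21] at q0012_2
  have q0012_3 := congrFun q0012 3
  simp only [Pi.add_apply, Pi.smul_apply, Pi.neg_apply, Pi.zero_apply, smul_eq_mul, c0, c1, c2, c3,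
    e10, e11, e20, e21] at q0012_3
  have q0013 := hco _ _ _ _ _ _ _ _ E1 E1 E2 F2
  simp only [Fc, Gc, m11, m12, m21, m22, ms1, ms2, mz1, mz2, mf1, mf2, mf3, mf4,
    map_smul, map_zero, LinearMap.smul_apply, LinearMap.zero_apply,
    s21, s31, s41, s32, s42, s43] at q0013
  have q0013_2 := congrFun q0013 2
  simp only [Pi.add_apply, Pi.smul_apply, Pi.neg_apply, Pi.zero_apply, smul_eq_mul, c0, c1, c2, c3,
    e10, e11, e20, e21] at q0013_2
  have q0013_3 := congrFun q0013 3
  simp only [Pi.add_apply, Pi.smul_apply, Pi.neg_apply, Pi.zero_apply, smul_eq_mul, c0, c1, c2, c3,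
    e10, e11, e20, e21] at q0013_3
  have q0023 := hco _ _ _ _ _ _ _ _ E1 E1 F1 F2
  simp only [Fc, Gc, m11, m12, m21, m22, ms1, ms2, mz1, mz2, mf1, mf2, mf3, mf4,
    map_smul, map_zero, LinearMap.smul_apply, LinearMap.zero_apply,
    s21, s31, s41, s32, s42, s43] at q0023
  have q0023_0 := congrFun q0023 0
  simp only [Pi.add_apply, Pi.smul_apply, Pi.neg_apply, Pi.zero_apply, smul_eq_mul, c0, c1, c2, c3,
    e10, e11, e20, e21] at q0023_0
  have q0023_1 := congrFun q0023 1
  simp only [Pi.add_apply, Pi.smul_apply, Pi.neg_apply, Pi.zero_apply, smul_eq_mul, c0, c1, c2, c3,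
    e10, e11, e20, e21] at q0023_1
  have q0101 := hco _ _ _ _ _ _ _ _ E1 E2 E1 E2
  simp only [Fc, Gc, m11, m12, m21, m22, ms1, ms2, mz1, mz2, mf1, mf2, mf3, mf4,
    map_smul, map_zero, LinearMap.smul_apply, LinearMap.zero_apply,
    s21, s31, s41, s32, s42, s43] at q0101
  have q0101_1 := congrFun q0101 1
  simp only [Pi.add_apply, Pi.smul_apply, Pi.neg_apply, Pi.zero_apply, smul_eq_mul, c0, c1, c2, c3,
    e10, e11, e20, e21] at q0101_1
  have q1101 := hco _ _ _ _ _ _ _ _ E2 E2 E1 E2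
  simp only [Fc, Gc, m11, m12, m21, m22, ms1, ms2, mz1, mz2, mf1, mf2, mf3, mf4,
    map_smul, map_zero, LinearMap.smul_apply, LinearMap.zero_apply,
    s21, s31, s41, s32, s42, s43] at q1101
  have q1101_1 := congrFun q1101 1
  simp only [Pi.add_apply, Pi.smul_apply, Pi.neg_apply, Pi.zero_apply, smul_eq_mul, c0, c1, c2, c3,
    e10, e11, e20, e21] at q1101_1
  have A := eq_of_mem_J0 F (h00 _ (e1_mem F) _ (e1_mem F)) (a := h (e1 F) (e1 F) 0) (b := 0)
    rfl (by linear_combination (-4 / 3) * q0000_1)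
  have B := eq_of_mem_J0 F (h00 _ (e1_mem F) _ (e2_mem F)) (a := h (e2 F) (e2 F) 1 / 2)
    (b := h (e1 F) (e1 F) 0 / 2)
    (by linear_combination 2 * q0101_1) (by linear_combination (-2) * q0001_1)
  have C := eq_of_mem_J0 F (h00 _ (e2_mem F) _ (e2_mem F)) (a := 0) (b := h (e2 F) (e2 F) 1)
    (by linear_combination (4 / 3) * q1101_1) rfl
  have D := eq_zero_of_mem_J1 F (h01 _ (e1_mem F) _ (f1_mem F))
    (by linear_combination q0002_2) (by linear_combination q0002_3)
  have E := eq_zero_of_mem_J1 F (h01 _ (e1_mem F) _ (f2_mem F))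
    (by linear_combination q0003_2) (by linear_combination q0003_3)
  have G := eq_zero_of_mem_J1 F (h01 _ (e2_mem F) _ (f1_mem F))
    (by linear_combination 2 * q0012_2) (by linear_combination 2 * q0012_3)
  have K := eq_zero_of_mem_J1 F (h01 _ (e2_mem F) _ (f2_mem F))
    (by linear_combination 2 * q0013_2) (by linear_combination 2 * q0013_3)
  have L := eq_of_mem_J0 F (h11 _ (f1_mem F) _ (f2_mem F)) (a := 0) (b := 0)
    (by linear_combination (-1) * q0023_0) (by linear_combination (-2) * q0023_1)
  generalize h (e1 F) (e1 F) 0 = p at *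
  generalize h (e2 F) (e2 F) 1 = r at *
  simp only [zero_smul, add_zero, zero_add] at A B C L
  refine ⟨(p • LinearMap.proj 0 + r • LinearMap.proj 1 : J F →ₗ[F] F).smulRight (e1 F),
    ⟨?_, ?_⟩, ?_⟩
  · intro a _
    exact Submodule.smul_mem _ _ (e1_mem F)
  · intro a ha
    obtain ⟨h0, h1⟩ := mem_J1 F ha
    simp [h0, h1]
  · intro a b
    have key : h a b = (a 0 * b 0) • (p • e1 F)
        + (a 0 * b 1 + a 1 * b 0) • ((r / 2) • e1 F + (p / 2) • e2 F)
        + (a 1 * b 1) • (r • e2 F) := by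
      conv_lhs => rw [decomp F a, decomp F b]
      simp only [map_add, map_smul, LinearMap.add_apply, LinearMap.smul_apply, s21, s31, s41,
        s32, s42, s43, s33, s44, A, B, C, D, E, G, K, L]
      module
    rw [key]
    ext i
    fin_cases i <;> simp [mul52, e1, e2] <;> ring

end JS22
end

section
/- Let J be the superalgebra (2,2)₆₀. For every even supersymmetric 2-cocycle h : J × J → J there exists an even F-linear map μ : J → J with h(a,b) = aμ(b) + μ(a)b − μ(ab) for all a, b; that is, the even part of the second cohomology group H²(J,J) vanishes. -/
namespace JS22

variable (F : Type*) [Field F] [CharZero F]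

lemma mem_J0_iff (x : J F) : x ∈ J0 F ↔ x 2 = 0 ∧ x 3 = 0 := by
  unfold J0
  rw [Submodule.mem_span_pair]
  constructor
  · rintro ⟨a, b, rfl⟩
    simp [e1, e2]
  · rintro ⟨h2, h3⟩
    refine ⟨x 0, x 1, ?_⟩
    ext k
    fin_cases k <;> simp [e1, e2, h2, h3]

lemma mem_J1_iff (x : J F) : x ∈ J1 F ↔ x 0 = 0 ∧ x 1 = 0 := by
  unfold J1
  rw [Submodule.mem_span_pair]
  constructor
  · rintro ⟨a, b, rfl⟩
    simp [f1, f2]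
  · rintro ⟨h2, h3⟩
    refine ⟨x 2, x 3, ?_⟩
    ext k
    fin_cases k <;> simp [f1, f2, h2, h3]

lemma vec_eq (a : J F) :
    a = a 0 • e1 F + a 1 • e2 F + a 2 • f1 F + a 3 • f2 F := by
  ext k
  fin_cases k <;> simp [e1, e2, f1, f2]

set_option maxHeartbeats 4000000 in
/-- for `J = (2,2)₆₀`, every even supersymmetric 2-cocycle is the
coboundary of an even linear map, i.e. the even part of `H²(J,J)` vanishes. -/
theorem even_H2_vanishes_mul60 (h : J F →ₗ[F] J F →ₗ[F] J F)
    (hev : IsEvenBilin F h) (hc : IsSuperCocycle F (mul60 F) h) :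
    ∃ μ : J F →ₗ[F] J F, IsEvenLin F μ ∧
      ∀ a b : J F, h a b = mul60 F a (μ b) + mul60 F (μ a) b - μ (mul60 F a b) := by
  have e1h : IsHomog F (e1 F) 0 := Or.inl ⟨rfl, by simp [mem_J0_iff, e1]⟩
  have e2h : IsHomog F (e2 F) 0 := Or.inl ⟨rfl, by simp [mem_J0_iff, e2]⟩
  have f1h : IsHomog F (f1 F) 1 := Or.inr ⟨rfl, by simp [mem_J1_iff, f1]⟩
  have f2h : IsHomog F (f2 F) 1 := Or.inr ⟨rfl, by simp [mem_J1_iff, f2]⟩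
  have e1m : e1 F ∈ J0 F := by simp [mem_J0_iff, e1]
  have e2m : e2 F ∈ J0 F := by simp [mem_J0_iff, e2]
  have f1m : f1 F ∈ J1 F := by simp [mem_J1_iff, f1]
  have f2m : f2 F ∈ J1 F := by simp [mem_J1_iff, f2]
  obtain ⟨hs, hc⟩ := hc
  obtain ⟨h00, h01, h10, h11⟩ := hev
  have two : (2 : F) ≠ 0 := two_ne_zero
  -- parity
  have p00 := (mem_J0_iff F _).1 (h00 _ e1m _ e1m)
  have p01 := (mem_J0_iff F _).1 (h00 _ e1m _ e2m)
  have p11 := (mem_J0_iff F _).1 (h00 _ e2m _ e2m)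
  have p02 := (mem_J1_iff F _).1 (h01 _ e1m _ f1m)
  have p03 := (mem_J1_iff F _).1 (h01 _ e1m _ f2m)
  have p12 := (mem_J1_iff F _).1 (h01 _ e2m _ f1m)
  have p13 := (mem_J1_iff F _).1 (h01 _ e2m _ f2m)
  have p23 := (mem_J0_iff F _).1 (h11 _ f1m _ f2m)
  -- supersymmetry
  have s10 : h (e2 F) (e1 F) = h (e1 F) (e2 F) := by simpa using hs _ _ _ _ e2h e1h
  have s20 : h (f1 F) (e1 F) = h (e1 F) (f1 F) := by simpa using hs _ _ _ _ f1h e1h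
  have s30 : h (f2 F) (e1 F) = h (e1 F) (f2 F) := by simpa using hs _ _ _ _ f2h e1h
  have s21 : h (f1 F) (e2 F) = h (e2 F) (f1 F) := by simpa using hs _ _ _ _ f1h e2h
  have s31 : h (f2 F) (e2 F) = h (e2 F) (f2 F) := by simpa using hs _ _ _ _ f2h e2h
  have s32 : h (f2 F) (f1 F) = - h (f1 F) (f2 F) := by simpa using hs _ _ _ _ f2h f1h
  have s22 : h (f1 F) (f1 F) = 0 := by
    have := hs _ _ _ _ f1h f1h
    simpa [self_eq_neg] using this
  have s33 : h (f2 F) (f2 F) = 0 := by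
    have := hs _ _ _ _ f2h f2h
    simpa [self_eq_neg] using this
  -- cocycle identities
  have c1 := hc _ _ _ _ _ _ _ _ e1h e1h e1h e1h
  have c2 := hc _ _ _ _ _ _ _ _ e1h e1h e1h e2h
  have c3 := hc _ _ _ _ _ _ _ _ e1h e1h e1h f1h
  have c4 := hc _ _ _ _ _ _ _ _ e1h e1h e1h f2h
  have c5 := hc _ _ _ _ _ _ _ _ e1h e2h e1h e2h
  have c6 := hc _ _ _ _ _ _ _ _ e1h e2h e1h f1h
  have c7 := hc _ _ _ _ _ _ _ _ e1h e2h e1h f2h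
  have c8 := hc _ _ _ _ _ _ _ _ e1h f1h e1h f2h
  have c9 := hc _ _ _ _ _ _ _ _ e2h e2h e1h e2h
  have c10 := hc _ _ _ _ _ _ _ _ e2h f1h e1h f2h
  have hex : ∀ a b, h a b =
      (a 0 * b 0) • h (e1 F) (e1 F) + (a 0 * b 1 + a 1 * b 0) • h (e1 F) (e2 F)
      + (a 1 * b 1) • h (e2 F) (e2 F)
      + (a 0 * b 2 + a 2 * b 0) • h (e1 F) (f1 F) + (a 0 * b 3 + a 3 * b 0) • h (e1 F) (f2 F)
      + (a 1 * b 2 + a 2 * b 1) • h (e2 F) (f1 F) + (a 1 * b 3 + a 3 * b 1) • h (e2 F) (f2 F)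
      + (a 2 * b 3 - a 3 * b 2) • h (f1 F) (f2 F) := by
    intro a b
    conv_lhs => rw [vec_eq F a, vec_eq F b]
    simp only [map_add, map_smul, LinearMap.add_apply, LinearMap.smul_apply, smul_add, smul_smul,
      s10, s20, s30, s21, s31, s32, s22, s33]
    module
  generalize h (e1 F) (e1 F) = A at *
  generalize h (e1 F) (e2 F) = B at *
  generalize h (e2 F) (e2 F) = C at *
  generalize h (e1 F) (f1 F) = P at *
  generalize h (e1 F) (f2 F) = Q at *
  generalize h (e2 F) (f1 F) = R at *
  generalize h (e2 F) (f2 F) = S at *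
  generalize h (f1 F) (f2 F) = T at *
  obtain ⟨pA2, pA3⟩ := p00
  obtain ⟨pB2, pB3⟩ := p01
  obtain ⟨pC2, pC3⟩ := p11
  obtain ⟨pP0, pP1⟩ := p02
  obtain ⟨pQ0, pQ1⟩ := p03
  obtain ⟨pR0, pR1⟩ := p12
  obtain ⟨pS0, pS1⟩ := p13
  obtain ⟨pT2, pT3⟩ := p23
  simp only [Fc, Gc, hex] at c1 c2 c3 c4 c5 c6 c7 c8 c9 c10
  have d1 := congrFun c1 1
  have d2 := congrFun c2 1
  have d3 := congrFun c3 2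
  have d4 := congrFun c3 3
  have d5 := congrFun c4 2
  have d6 := congrFun c4 3
  have d7 := congrFun c5 1
  have d8 := congrFun c6 2
  have d9 := congrFun c6 3
  have d10 := congrFun c7 2
  have d11 := congrFun c7 3
  have d12 := congrFun c8 1
  have d13 := congrFun c9 1
  have d14 := congrFun c10 1
  clear c1 c2 c3 c4 c5 c6 c7 c8 c9 c10
  simp [-Matrix.add_cons, -Matrix.cons_add, -Matrix.cons_add_cons, -Matrix.smul_cons,
    mul60, e1, e2, f1, f2, pA2, pA3, pB2, pB3, pC2, pC3, pP0, pP1, pQ0, pQ1,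
    pR0, pR1, pS0, pS1, pT2, pT3] at d1 d2 d3 d4 d5 d6 d7 d8 d9 d10 d11 d12 d13 d14
  have A1 : A 1 = 0 := by linear_combination (-4/3) * d1
  have B1 : B 1 = A 0 / 2 := by linear_combination (-2) * d2
  have P2 : P 2 = A 0 / 2 := by linear_combination (-2) * d3
  have P3 : P 3 = 0 := by linear_combination (-2) * d4
  have Q2 : Q 2 = 0 := by linear_combination (-2) * d5
  have Q3 : Q 3 = A 0 / 2 := by linear_combination (-2) * d6
  have C1 : C 1 = 2 * B 0 := by linear_combination (-4) * d7
  have R2 : R 2 = B 0 := by linear_combination (-4) * d8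
  have R3 : R 3 = 0 := by linear_combination (-4) * d9
  have S2 : S 2 = 0 := by linear_combination (-4) * d10
  have S3 : S 3 = B 0 := by linear_combination (-4) * d11
  have T1 : T 1 = 0 := by linear_combination (-4) * d12
  have C0 : C 0 = 0 := by linear_combination (4/3) * d13
  have T0 : T 0 = 0 := by linear_combination 2 * d14
  let ν : J F →ₗ[F] F := A 0 • LinearMap.proj 0 + (2 * B 0) • LinearMap.proj 1
  have hν : ∀ x, ν.smulRight (e1 F) x = (A 0 * x 0 + 2 * B 0 * x 1) • e1 F := by
    intro x
    simp [ν]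
  refine ⟨ν.smulRight (e1 F), ⟨?_, ?_⟩, ?_⟩
  · intro a _
    rw [hν]
    exact Submodule.smul_mem _ _ e1m
  · intro a ha
    rw [mem_J1_iff] at ha
    rw [hν, ha.1, ha.2]
    simp
  · intro a b
    rw [hν, hν, hν, hex]
    ext k
    fin_cases k <;> simp [-Matrix.add_cons, -Matrix.cons_add, -Matrix.cons_add_cons, mul60, e1, pA2, pA3, pB2, pB3, pC2, pC3, pP0, pP1, pQ0, pQ1,
      pR0, pR1, pS0, pS1, pT2, pT3, A1, B1, P2, P3, Q2, Q3, C1, R2, R3, S2, S3, T1, C0, T0] <;>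
      ring

end JS22
end

section
/- For every γ ∈ F with γ ≠ 0, there is no graded algebra isomorphism from D_γ onto the superalgebra (2,2)₅₇. (Indeed, in D_γ every even element acts on the odd part as a scalar, whereas in (2,2)₅₇ the even element e₁ satisfies e₁f₂ = f₂ and e₁f₁ = 0, so multiplication by e₁ is not scalar on the odd part.) -/
namespace JS22

variable (F : Type*) [Field F] [CharZero F]

/-- for every `γ ≠ 0` there is no graded algebra isomorphism from `D_γ`
onto `(2,2)₅₇`. -/
theorem Dgamma_not_iso_alg57 (γ : F) (hγ : γ ≠ 0) :
    ¬ ∃ φ : J F → J F, IsGradedIso F (mulD F γ) (mul57 F) φ := by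
  rintro ⟨φ, -, hb, -, -, hm⟩
  obtain ⟨y, hy⟩ := hb.2 (f1 F)
  have hu : mulD F γ ![1, 1, 0, 0] y = y := by
    have h2 : (1 + 1 : F) ≠ 0 := by norm_num
    funext i
    fin_cases i <;> simp [mulD] <;> ring
  have h := hm ![1, 1, 0, 0] y
  rw [hu, hy] at h
  have h' := congrFun h 2
  simp [f1, mul57] at h'

end JS22
end

section
/- For every γ ∈ F with γ ≠ 0, the linear span of the set of products {x·y : x, y ∈ (D_γ)₁} equals the one-dimensional subspace F·(e₁ + γe₂). Consequently, D_γ is not isomorphic as a graded algebra to any superalgebra structure on J in which all products of odd elements vanish; in particular D_γ is not isomorphic to the superalgebra (2,2)₈. -/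
namespace JS22

variable (F : Type*) [Field F] [CharZero F]

theorem aux_mem_J1 (x : J F) (hx : x ∈ J1 F) : x 0 = 0 ∧ x 1 = 0 := by
  obtain ⟨a, b, rfl⟩ := Submodule.mem_span_pair.1 hx
  simp [f1, f2]

theorem aux_no_iso (γ : F) (m : J F → J F → J F)
    (hm : ∀ x ∈ J1 F, ∀ y ∈ J1 F, m x y = 0) :
    ¬ ∃ φ : J F → J F, IsGradedIso F (mulD F γ) m φ := by
  rintro ⟨φ, hl, hb, -, h1, hmul⟩
  have hf1 : f1 F ∈ J1 F := Submodule.subset_span (by simp)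
  have hf2 : f2 F ∈ J1 F := Submodule.subset_span (by simp)
  have k : ∀ x ∈ J1 F, φ x ∈ J1 F := fun x hx => by
    have : φ x ∈ φ '' (J1 F : Set (J F)) := ⟨x, hx, rfl⟩
    rw [h1] at this
    exact this
  have h := hmul (f1 F) (f2 F)
  rw [hm _ (k _ hf1) _ (k _ hf2), ← hl.map_zero] at h
  have h0 := congrFun (hb.1 h) 0
  simp [mulD, f1, f2] at h0

/-- for `γ ≠ 0`, the span of the products of odd elements of `D_γ` is
the line `F·(e₁ + γe₂)`; consequently `D_γ` is not isomorphic as a graded algebra to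
any superalgebra structure on `J` whose odd products all vanish; in particular `D_γ`
is not isomorphic to `(2,2)₈`. -/
theorem Dgamma_odd_products (γ : F) (hγ : γ ≠ 0) :
    Submodule.span F {z : J F | ∃ x ∈ J1 F, ∃ y ∈ J1 F, z = mulD F γ x y}
      = Submodule.span F {e1 F + γ • e2 F} ∧
    (∀ m : J F →ₗ[F] J F →ₗ[F] J F, (∀ x ∈ J1 F, ∀ y ∈ J1 F, m x y = 0) →
      ¬ ∃ φ : J F → J F, IsGradedIso F (mulD F γ) (fun a b => m a b) φ) ∧
    ¬ ∃ φ : J F → J F, IsGradedIso F (mulD F γ) (mul8 F) φ := by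
  refine ⟨le_antisymm ?_ ?_, fun m hm => aux_no_iso F γ _ hm, aux_no_iso F γ _ ?_⟩
  · rw [Submodule.span_le]
    rintro z ⟨x, hx, y, hy, rfl⟩
    obtain ⟨hx0, hx1⟩ := aux_mem_J1 F x hx
    obtain ⟨hy0, hy1⟩ := aux_mem_J1 F y hy
    refine Submodule.mem_span_singleton.2 ⟨x 2 * y 3 - x 3 * y 2, ?_⟩
    ext i
    fin_cases i <;> simp [mulD, e1, e2, hx0, hx1, hy0, hy1, mul_comm]
  · rw [Submodule.span_le, Set.singleton_subset_iff]
    refine Submodule.subset_span ⟨f1 F, Submodule.subset_span (by simp),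
      f2 F, Submodule.subset_span (by simp), ?_⟩
    ext i
    fin_cases i <;> simp [mulD, e1, e2, f1, f2]
  · intro x hx y hy
    obtain ⟨hx0, hx1⟩ := aux_mem_J1 F x hx
    obtain ⟨hy0, hy1⟩ := aux_mem_J1 F y hy
    ext i
    fin_cases i <;> simp [mul8, hx0, hx1, hy0, hy1]

end JS22
end
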